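/- Let n ≥ 1, let Ω ⊆ 𝕆_sⁿ be an axially symmetric slice-domain, and let f : Ω → 𝕆 be weak slice regular. Then f is strong slice regular. -/

import Mathlib

/-! Octonions via the Cayley–Dickson construction on the quaternions,
the n-dimensional quadratic cone, the slice topology, and slice regularity. -/

noncomputable section
open Quaternion Topology

/-- The octonions, as `ℍ × ℍ` with the (L²) Euclidean norm and
Cayley–Dickson multiplication. -/
abbrev Oct : Type := WithLp 2 (ℍ × ℍ)

namespace Oct

def c1 (p : Oct) : ℍ := (WithLp.equiv 2 (ℍ × ℍ) p).1
def c2 (p : Oct) : ℍ := (WithLp.equiv 2 (ℍ × ℍ) p).2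
def mk (a b : ℍ) : Oct := (WithLp.equiv 2 (ℍ × ℍ)).symm (a, b)

instance : One Oct := ⟨mk 1 0⟩

/-- Cayley–Dickson multiplication. -/
instance : Mul Oct :=
  ⟨fun p q => mk (c1 p * c1 q - star (c2 q) * c2 p) (c2 q * c1 p + c2 p * star (c1 q))⟩

/-- Octonionic conjugation. -/
instance : Star Oct := ⟨fun p => mk (star (c1 p)) (-(c2 p))⟩

/-- Inverse: `p⁻¹ = ‖p‖⁻² • (star p)` (so `0⁻¹ = 0`). -/
instance : Inv Oct := ⟨fun p => (‖p‖ ^ 2)⁻¹ • star p⟩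

/-- The real inner product on `𝕆 ≅ ℝ⁸`, via polarization. -/
def oinner (p q : Oct) : ℝ := (1 / 4) * (‖p + q‖ ^ 2 - ‖p - q‖ ^ 2)

/-- The sphere `𝕊` of imaginary units of the octonions. -/
def Sph : Set Oct := {I | I * I = -1}

/-- The slice complex plane `ℂ_I = ℝ + ℝ I ⊆ 𝕆`. -/
def CI (I : Oct) : Set Oct := {z | ∃ s t : ℝ, z = s • (1 : Oct) + t • I}

end Oct

open Oct

/-- The point `x + y I ∈ ℂ_Iⁿ ⊆ 𝕆ⁿ`. -/
def aff {n : ℕ} (x y : Fin n → ℝ) (I : Oct) : Fin n → Oct :=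
  fun m => x m • (1 : Oct) + y m • I

/-- The embedding `ℝⁿ ⊆ 𝕆ⁿ`. -/
def ofRealn {n : ℕ} (x : Fin n → ℝ) : Fin n → Oct := fun m => x m • (1 : Oct)

/-- The slice `ℂ_Iⁿ ⊆ 𝕆ⁿ`. -/
def slicen (n : ℕ) (I : Oct) : Set (Fin n → Oct) := {q | ∃ x y : Fin n → ℝ, q = aff x y I}

/-- The `n`-dimensional quadratic cone `𝕆ₛⁿ = ⋃_{I ∈ 𝕊} ℂ_Iⁿ`. -/
def cone (n : ℕ) : Set (Fin n → Oct) := ⋃ I ∈ Sph, slicen n I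

/-- The slice topology `τ_s`: a set is open iff its trace on every slice `ℂ_Iⁿ`
is open (expressed via the canonical parametrizations `(x,y) ↦ x + yI`). -/
def τs (n : ℕ) : TopologicalSpace (Fin n → Oct) :=
  ⨆ I : Sph, TopologicalSpace.coinduced
    (fun p : (Fin n → ℝ) × (Fin n → ℝ) => aff p.1 p.2 I.1) inferInstance

/-- A slice-open subset of the quadratic cone. -/
def SliceOpen (n : ℕ) (Ω : Set (Fin n → Oct)) : Prop :=
  Ω ⊆ cone n ∧ IsOpen[τs n] Ω

/-- A slice-domain: a nonempty slice-connected slice-open subset of the cone. -/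
def SliceDomain (n : ℕ) (Ω : Set (Fin n → Oct)) : Prop :=
  SliceOpen n Ω ∧ @IsConnected _ (τs n) Ω

/-- Real-connectedness: `Ω ∩ ℝⁿ` is a (pre)connected subset of `ℝⁿ`. -/
def RealConnected (n : ℕ) (Ω : Set (Fin n → Oct)) : Prop :=
  IsPreconnected {x : Fin n → ℝ | ofRealn x ∈ Ω}

/-- Axially symmetric subsets of the cone. -/
def AxSymm (n : ℕ) (Ω : Set (Fin n → Oct)) : Prop :=
  ∀ (x y : Fin n → ℝ), ∀ I ∈ Sph, ∀ J ∈ Sph, aff x y I ∈ Ω → aff x y J ∈ Ω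

/-- The upper half-space `ℝ²ⁿ₊`: pairs `(x,y)` with `y = 0` or the first
nonzero coordinate of `y` positive. -/
def pos2n (n : ℕ) : Set ((Fin n → ℝ) × (Fin n → ℝ)) :=
  {p | p.2 = 0 ∨ ∃ m : Fin n, 0 < p.2 m ∧ ∀ k : Fin n, k < m → p.2 k = 0}

/-- `Ω_{s₁}`. -/
def s1 {n : ℕ} (Ω : Set (Fin n → Oct)) : Set ((Fin n → ℝ) × (Fin n → ℝ)) :=
  {p | ∃ I ∈ Sph, aff p.1 p.2 I ∈ Ω}

/-- `Ω_{s₂}`. -/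
def s2 {n : ℕ} (Ω : Set (Fin n → Oct)) : Set ((Fin n → ℝ) × (Fin n → ℝ)) :=
  {p | ∃ J ∈ Sph, ∃ K ∈ Sph, J ≠ K ∧ aff p.1 p.2 J ∈ Ω ∧ aff p.1 p.2 K ∈ Ω}

/-- Slice functions: induced on `Ω_{s₂}⁺` by a pair `(F₁, F₂)` via
`f(x + yI) = F₁(x,y) + I·F₂(x,y)`. -/
def IsSliceFun (n : ℕ) (Ω : Set (Fin n → Oct)) (f : (Fin n → Oct) → Oct) : Prop :=
  ∃ F₁ F₂ : (Fin n → ℝ) × (Fin n → ℝ) → Oct,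
    ∀ x y : Fin n → ℝ, (x, y) ∈ s2 Ω ∩ pos2n n → ∀ I ∈ Sph, aff x y I ∈ Ω →
      f (aff x y I) = F₁ (x, y) + I * F₂ (x, y)

/-- Holomorphy of a function of `n` slice variables, read through the
parametrization `(x,y) ↦ x + yI`: continuous partial derivatives (i.e. `C¹`)
and the Cauchy–Riemann equations `(∂/∂xₘ + I ∂/∂yₘ) g = 0` on `U`. -/
def Holo (n : ℕ) (I : Oct) (g : (Fin n → ℝ) × (Fin n → ℝ) → Oct)
    (U : Set ((Fin n → ℝ) × (Fin n → ℝ))) : Prop :=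
  ContDiffOn ℝ 1 g U ∧
  ∀ p ∈ U, ∀ m : Fin n,
    fderiv ℝ g p (Pi.single m 1, 0) + I * fderiv ℝ g p (0, Pi.single m 1) = 0

/-- Weak slice regularity: each restriction `f|_{Ω ∩ ℂ_Iⁿ}` is holomorphic. -/
def WSliceReg (n : ℕ) (Ω : Set (Fin n → Oct)) (f : (Fin n → Oct) → Oct) : Prop :=
  ∀ I ∈ Sph, Holo n I (fun p => f (aff p.1 p.2 I)) {p | aff p.1 p.2 I ∈ Ω}

/-- The complex structure `σ(a,b) = (−b,a)` on `𝕆²`. -/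
def sigma2 : Oct × Oct → Oct × Oct := fun w => (-w.2, w.1)

/-- Holomorphic stem maps: `F : V → 𝕆²` extends to a `C¹` map `G` on an open
neighborhood `U ⊇ V` satisfying `(∂/∂xₘ + σ ∂/∂yₘ) G = 0` on `U`. -/
def StemHolo (n : ℕ) (V : Set ((Fin n → ℝ) × (Fin n → ℝ)))
    (F : (Fin n → ℝ) × (Fin n → ℝ) → Oct × Oct) : Prop :=
  ∃ (U : Set ((Fin n → ℝ) × (Fin n → ℝ))) (G : (Fin n → ℝ) × (Fin n → ℝ) → Oct × Oct),
    IsOpen U ∧ V ⊆ U ∧ Set.EqOn G F V ∧ ContDiffOn ℝ 1 G U ∧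
    ∀ p ∈ U, ∀ m : Fin n,
      fderiv ℝ G p (Pi.single m 1, 0) + sigma2 (fderiv ℝ G p (0, Pi.single m 1)) = 0

/-- Strong slice regularity: `f` is induced by a holomorphic stem map on `Ω_{s₁}`. -/
def SSliceReg (n : ℕ) (Ω : Set (Fin n → Oct)) (f : (Fin n → Oct) → Oct) : Prop :=
  ∃ F : (Fin n → ℝ) × (Fin n → ℝ) → Oct × Oct, StemHolo n (s1 Ω) F ∧
    ∀ x y : Fin n → ℝ, ∀ I ∈ Sph, aff x y I ∈ Ω →
      f (aff x y I) = (F (x, y)).1 + I * (F (x, y)).2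

/-- An s-basis `{I, J, K}` of the octonions. -/
def IsSBasis (I J K : Oct) : Prop :=
  I ∈ Sph ∧ J ∈ Sph ∧ K ∈ Sph ∧
  LinearIndependent ℝ ![(1 : Oct), I, J, I * J, K, J * K, I * K, (I * J) * K] ∧
  Submodule.span ℝ (Set.range ![(1 : Oct), I, J, I * J, K, J * K, I * K, (I * J) * K]) = ⊤

/-- Iterated left multiplication `L_w^β = (L_{w₁})^{β₁} ∘ ⋯ ∘ (L_{wₙ})^{βₙ}`. -/
def Lpow {n : ℕ} (w : Fin n → Oct) (β : Fin n → ℕ) : Oct → Oct :=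
  fun a => (List.finRange n).foldr (fun ℓ c => (fun o => w ℓ * o)^[β ℓ] c) a

/-- The `*`-power `(q − p)^{*α} a = ∑_{β ≤ α} C(α,β) L_q^β (L_{−p}^{α−β} a)`. -/
def starPow {n : ℕ} (p : Fin n → Oct) (α : Fin n → ℕ) (a : Oct) (q : Fin n → Oct) : Oct :=
  ∑ β ∈ Finset.Iic α, (∏ ℓ, (α ℓ).choose (β ℓ)) • Lpow q β (Lpow (-p) (α - β) a)

/-- The `ℓ`-th slice derivative `∂_ℓ f (x + w) = (∂/∂x_ℓ) f (x + w)`. -/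
def sderiv {n : ℕ} (ℓ : Fin n) (f : (Fin n → Oct) → Oct) : (Fin n → Oct) → Oct :=
  fun q => deriv (fun t : ℝ => f (fun m => q m + (if m = ℓ then t else 0) • (1 : Oct))) 0

/-- The iterated slice derivative `f^{(α)} = (∂₁)^{α₁} ⋯ (∂ₙ)^{αₙ} f`. -/
def sderivMulti {n : ℕ} (α : Fin n → ℕ) (f : (Fin n → Oct) → Oct) : (Fin n → Oct) → Oct :=
  (List.finRange n).foldr (fun ℓ g => (sderiv ℓ)^[α ℓ] g) f

/-- The slice-polydisc `P̃(q₀, r)` (relative to `I ∈ 𝕊` with `q₀ ∈ ℂ_Iⁿ`):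
points `x + yJ` with `x ± yI` in the closed polydisc `P_I(q₀, r)`. -/
def polyDisc {n : ℕ} (q₀ : Fin n → Oct) (I : Oct) (r : Fin n → ℝ) : Set (Fin n → Oct) :=
  {q | ∃ x y : Fin n → ℝ, ∃ J ∈ Sph, q = aff x y J ∧
        (∀ ℓ, ‖aff x y I ℓ - q₀ ℓ‖ ≤ r ℓ) ∧ (∀ ℓ, ‖aff x (-y) I ℓ - q₀ ℓ‖ ≤ r ℓ)}

/-! Holomorphy with respect to a complex structure `T` on the target. -/

section ComplexStructure

variable {n : ℕ} {E : Type*} [NormedAddCommGroup E] [NormedSpace ℝ E]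

/-- `C¹` maps satisfying the Cauchy–Riemann equations with respect to an endomorphism `T`
of the target. -/
def HoloWrt (T : E →L[ℝ] E) (h : (Fin n → ℝ) × (Fin n → ℝ) → E)
    (V : Set ((Fin n → ℝ) × (Fin n → ℝ))) : Prop :=
  ContDiffOn ℝ 1 h V ∧
  ∀ p ∈ V, ∀ m : Fin n,
    fderiv ℝ h p (Pi.single m 1, 0) + T (fderiv ℝ h p (0, Pi.single m 1)) = 0

/-- The Cauchy–Riemann equations extend from coordinate directions to all directions. -/
theorem cauchyRiemann_direction {T : E →L[ℝ] E}
    {D : (Fin n → ℝ) × (Fin n → ℝ) →L[ℝ] E}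
    (hD : ∀ m : Fin n, D (Pi.single m 1, 0) + T (D (0, Pi.single m 1)) = 0) (u : Fin n → ℝ) :
    D (u, 0) + T (D (0, u)) = 0 := by
  have key : D.toLinearMap ∘ₗ LinearMap.inl ℝ _ _ +
      T.toLinearMap ∘ₗ D.toLinearMap ∘ₗ LinearMap.inr ℝ _ _ = 0 := by
    apply LinearMap.pi_ext'
    intro m
    ext
    simpa using hD m
  simpa using LinearMap.congr_fun key u

/-- The real-linear parametrization `ζ ↦ ζ (u + iv)` of a complex line in `ℝⁿ × ℝⁿ`. -/
def complexLine (w : (Fin n → ℝ) × (Fin n → ℝ)) : ℂ →L[ℝ] (Fin n → ℝ) × (Fin n → ℝ) :=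
  Complex.reCLM.smulRight w + Complex.imCLM.smulRight (-w.2, w.1)

theorem complexLine_apply (w : (Fin n → ℝ) × (Fin n → ℝ)) (ζ : ℂ) :
    complexLine w ζ = ζ.re • w + ζ.im • (-w.2, w.1) := rfl

/-- The complexification `x ↦ ℓ x - i ℓ (T x)` of a real functional along `T`. -/
def complexifyDual (T : E →L[ℝ] E) (ℓ : E →L[ℝ] ℝ) : E →L[ℝ] ℂ :=
  Complex.ofRealCLM ∘L ℓ - Complex.I • (Complex.ofRealCLM ∘L ℓ ∘L T)

theorem complexifyDual_apply (T : E →L[ℝ] E) (ℓ : E →L[ℝ] ℝ) (x : E) :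
    complexifyDual T ℓ x = ℓ x - Complex.I * ℓ (T x) := rfl

theorem complexifyDual_map {T : E →L[ℝ] E} (hT : ∀ x, T (T x) = -x) (ℓ : E →L[ℝ] ℝ) (x : E) :
    complexifyDual T ℓ (T x) = Complex.I * complexifyDual T ℓ x := by
  simp only [complexifyDual_apply, hT, map_neg, Complex.ofReal_neg]
  linear_combination (ℓ (T x) : ℂ) * Complex.I_mul_I

variable {T : E →L[ℝ] E} {h : (Fin n → ℝ) × (Fin n → ℝ) → E}
  {V : Set ((Fin n → ℝ) × (Fin n → ℝ))}

theorem HoloWrt.differentiableAt_comp_complexLine (hT : ∀ x, T (T x) = -x) (hV : IsOpen V)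
    (hh : HoloWrt T h V) (ℓ : E →L[ℝ] ℝ) (z w : (Fin n → ℝ) × (Fin n → ℝ)) {ζ : ℂ}
    (hζ : z + complexLine w ζ ∈ V) :
    DifferentiableAt ℂ (fun ζ => complexifyDual T ℓ (h (z + complexLine w ζ))) ζ := by
  have hd : HasFDerivAt h (fderiv ℝ h (z + complexLine w ζ)) (z + complexLine w ζ) :=
    ((hh.1.differentiableOn one_ne_zero).differentiableAt (hV.mem_nhds hζ)).hasFDerivAt
  have hcr := cauchyRiemann_direction (hh.2 _ hζ)
  set D := fderiv ℝ h (z + complexLine w ζ)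
  have hc := (complexifyDual T ℓ).hasFDerivAt.comp ζ
    (hd.comp ζ ((complexLine w).hasFDerivAt.const_add z))
  refine differentiableAt_complex_iff_differentiableAt_real.2 ⟨hc.differentiableAt, ?_⟩
  have hf := hc.fderiv
  simp only [Function.comp_def] at hf
  rw [hf]
  have h1 : D (-w.2, w.1) = T (D w) := by
    have e1 : D (-w.2, w.1) = -D (w.2, 0) + D (0, w.1) := by
      rw [← map_neg, ← map_add]; simp
    have e2 : D w = D (w.1, 0) + D (0, w.2) := by
      rw [← map_add]; simp
    rw [e1, e2, eq_neg_of_add_eq_zero_left (hcr w.1), eq_neg_of_add_eq_zero_left (hcr w.2)]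
    simp only [map_add, map_neg, hT, neg_neg]
    abel
  simp [complexLine_apply, h1, complexifyDual_map hT]

theorem HoloWrt.eq_zero_of_complexLine (hT : ∀ x, T (T x) = -x) (hV : IsOpen V)
    (hh : HoloWrt T h V) {B : Set ((Fin n → ℝ) × (Fin n → ℝ))} (hB : IsOpen B)
    (hBc : Convex ℝ B) (hBV : B ⊆ V) {z w : (Fin n → ℝ) × (Fin n → ℝ)} (hz : z ∈ B) {ζ : ℂ}
    (hζ : z + complexLine w ζ ∈ B)
    (h0 : ∃ᶠ ξ in 𝓝[≠] (0 : ℂ), h (z + complexLine w ξ) = 0) :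
    h (z + complexLine w ζ) = 0 := by
  refine SeparatingDual.eq_zero_of_forall_dual_eq_zero (R := ℝ) fun ℓ => ?_
  set U : Set ℂ := (fun ξ => z + complexLine w ξ) ⁻¹' B
  have hUo : IsOpen U := hB.preimage (by fun_prop)
  have hUc : Convex ℝ U := by
    have := (hBc.translate_preimage_right z).linear_preimage (complexLine w).toLinearMap
    simpa [U, Set.preimage_preimage] using this
  have han : AnalyticOnNhd ℂ (fun ξ => complexifyDual T ℓ (h (z + complexLine w ξ))) U :=
    DifferentiableOn.analyticOnNhd (fun ξ hξ =>
      (hh.differentiableAt_comp_complexLine hT hV ℓ z w (hBV hξ)).differentiableWithinAt) hUo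
  have hU0 : (0 : ℂ) ∈ U := by simpa [U] using hz
  have := han.eqOn_zero_of_preconnected_of_frequently_eq_zero hUc.isPreconnected hU0
    (h0.mono fun ξ hξ => by simp [hξ]) hζ
  simpa [complexifyDual_apply] using congrArg Complex.re this

/-- The set of points near which `h` vanishes identically is relatively closed. -/
theorem HoloWrt.isOpen_diff_interior_zeros (hT : ∀ x, T (T x) = -x) (hV : IsOpen V)
    (hh : HoloWrt T h V) : IsOpen (V \ interior {p | h p = 0}) := by
  have key : V ∩ closure (interior {p | h p = 0}) ⊆ interior {p | h p = 0} := by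
    rintro p ⟨hpV, hpc⟩
    obtain ⟨r, hr, hball⟩ := Metric.isOpen_iff.1 hV p hpV
    obtain ⟨z, hzB, hz⟩ :=
      mem_closure_iff.1 hpc _ Metric.isOpen_ball (Metric.mem_ball_self hr)
    refine mem_interior.2 ⟨_, fun q hq => ?_, Metric.isOpen_ball, Metric.mem_ball_self hr⟩
    have hev : ∀ᶠ ξ in 𝓝 (0 : ℂ), h (z + complexLine (q - z) ξ) = 0 := by
      have hc : Filter.Tendsto (fun ξ => z + complexLine (q - z) ξ) (𝓝 0) (𝓝 z) := by
        have : Continuous fun ξ => z + complexLine (q - z) ξ := by fun_prop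
        simpa using this.tendsto 0
      exact hc.eventually (mem_interior_iff_mem_nhds.1 hz)
    have h1 : z + complexLine (q - z) 1 = q := by simp [complexLine_apply]
    have := hh.eq_zero_of_complexLine hT hV Metric.isOpen_ball (convex_ball p r) hball hzB
      (w := q - z) (ζ := 1) (by rwa [h1]) (hev.filter_mono nhdsWithin_le_nhds).frequently
    rwa [h1] at this
  have : V \ interior {p | h p = 0} = V \ closure (interior {p | h p = 0}) :=
    Set.Subset.antisymm (fun p hp => ⟨hp.1, fun hc => hp.2 (key ⟨hp.1, hc⟩)⟩)
      (fun p hp => ⟨hp.1, fun hc => hp.2 (subset_closure hc)⟩)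
  rw [this]
  exact hV.sdiff isClosed_closure

theorem HoloWrt.mem_interior_zeros_of_real (hT : ∀ x, T (T x) = -x) (hV : IsOpen V)
    (hh : HoloWrt T h V) (h0 : ∀ x, (x, 0) ∈ V → h (x, 0) = 0) {x : Fin n → ℝ}
    (hx : (x, 0) ∈ V) : (x, 0) ∈ interior {p | h p = 0} := by
  obtain ⟨r, hr, hball⟩ := Metric.isOpen_iff.1 hV _ hx
  refine mem_interior.2 ⟨_, fun q hq => ?_, Metric.isOpen_ball, Metric.mem_ball_self hr⟩
  have hqB : (q.1, (0 : Fin n → ℝ)) ∈ Metric.ball (x, 0) r := by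
    simp only [Metric.mem_ball, Prod.dist_eq, max_lt_iff, dist_self] at hq ⊢
    exact ⟨hq.1, hr⟩
  have h1 : (q.1, (0 : Fin n → ℝ)) + complexLine (q.2, 0) Complex.I = q := by
    simp [complexLine_apply]
  have hev : ∀ᶠ t : ℝ in 𝓝 0,
      h ((q.1, (0 : Fin n → ℝ)) + complexLine (q.2, 0) (t : ℂ)) = 0 := by
    have hc : Continuous fun t : ℝ => (q.1, (0 : Fin n → ℝ)) + complexLine (q.2, 0) (t : ℂ) := by
      fun_prop
    have := hc.tendsto 0
    simp only [Complex.ofReal_zero, map_zero, add_zero] at this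
    filter_upwards [this (hV.mem_nhds (hball hqB))] with t ht
    have e : (q.1, (0 : Fin n → ℝ)) + complexLine (q.2, 0) (t : ℂ) = (q.1 + t • q.2, 0) := by
      simp [complexLine_apply]
    rw [e]
    rw [Set.mem_preimage, e] at ht
    exact h0 _ ht
  have hfr : ∃ᶠ ξ in 𝓝[≠] (0 : ℂ),
      h ((q.1, (0 : Fin n → ℝ)) + complexLine (q.2, 0) ξ) = 0 := by
    have ht : Filter.Tendsto Complex.ofReal (𝓝[≠] 0) (𝓝[≠] 0) := by
      refine tendsto_nhdsWithin_of_tendsto_nhds_of_eventually_within _ ?_ ?_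
      · simpa using (Complex.continuous_ofReal.tendsto 0).mono_left nhdsWithin_le_nhds
      · filter_upwards [self_mem_nhdsWithin] with t ht
        simpa using ht
    exact ht.frequently (hev.filter_mono nhdsWithin_le_nhds).frequently
  have := hh.eq_zero_of_complexLine hT hV Metric.isOpen_ball (convex_ball _ r) hball hqB
    (w := (q.2, 0)) (ζ := Complex.I) (by rwa [h1]) hfr
  rwa [h1] at this

end ComplexStructure

namespace Oct

theorem c1_mul (p q : Oct) : c1 (p * q) = c1 p * c1 q - star (c2 q) * c2 p := rfl
theorem c2_mul (p q : Oct) : c2 (p * q) = c2 q * c1 p + c2 p * star (c1 q) := rfl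
theorem c1_add (p q : Oct) : c1 (p + q) = c1 p + c1 q := rfl
theorem c2_add (p q : Oct) : c2 (p + q) = c2 p + c2 q := rfl
theorem c1_neg (p : Oct) : c1 (-p) = -c1 p := rfl
theorem c2_neg (p : Oct) : c2 (-p) = -c2 p := rfl
theorem c1_smul (r : ℝ) (p : Oct) : c1 (r • p) = r • c1 p := rfl
theorem c2_smul (r : ℝ) (p : Oct) : c2 (r • p) = r • c2 p := rfl
theorem c1_one : c1 1 = 1 := rfl
theorem c2_one : c2 1 = 0 := rfl
theorem c1_mk (a b : ℍ) : c1 (mk a b) = a := rfl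
theorem c2_mk (a b : ℍ) : c2 (mk a b) = b := rfl

theorem ext_c {p q : Oct} (h1 : c1 p = c1 q) (h2 : c2 p = c2 q) : p = q :=
  (WithLp.equiv 2 (ℍ × ℍ)).injective (Prod.ext h1 h2)

/-- Left multiplication as a continuous real-linear map. -/
def mulLeft (I : Oct) : Oct →L[ℝ] Oct :=
  LinearMap.toContinuousLinearMap
    { toFun := fun w => I * w
      map_add' := fun p q => by
        apply ext_c <;> simp only [c1_mul, c2_mul, c1_add, c2_add, star_add] <;> noncomm_ring
      map_smul' := fun r p => by
        apply ext_c <;>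
          simp only [c1_mul, c2_mul, c1_smul, c2_smul, RingHom.id_apply,
            Quaternion.star_smul, mul_smul_comm, smul_mul_assoc, smul_sub, smul_add] }

@[simp] theorem mulLeft_apply (I w : Oct) : mulLeft I w = I * w := rfl

theorem smul_mul_smul' (r : ℝ) (I : Oct) : (r • I) * (r • I) = (r * r) • (I * I) := by
  apply ext_c <;>
    simp only [c1_mul, c2_mul, c1_smul, c2_smul, Quaternion.star_smul, mul_smul_comm,
      smul_mul_assoc, smul_sub, smul_add, mul_smul]

theorem neg_mem_Sph {I : Oct} (hI : I ∈ Sph) : -I ∈ Sph := by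
  have h := smul_mul_smul' (-1) I
  have hI' : I * I = -1 := hI
  simpa [Sph, hI'] using h

theorem re_c1_of_mem_Sph {I : Oct} (hI : I ∈ Sph) : (c1 I).re = 0 := by
  have hI' : I * I = -1 := hI
  have h1 := congrArg c1 hI'
  have h2 := congrArg c2 hI'
  simp only [c1_mul, c2_mul, c1_neg, c2_neg, c1_one, c2_one] at h1 h2
  rw [Quaternion.ext_iff] at h1 h2
  simp at h1 h2
  by_contra hne
  obtain ⟨h10, h11, h12, h13⟩ := h1
  obtain ⟨h20, h21, h22, h23⟩ := h2
  have e (t : ℝ) (ht : (c1 I).re * t = 0) : t = 0 := (mul_eq_zero.1 ht).resolve_left hne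
  have b0 := e (c2 I).re (by rcases h20 with h | h <;> simp [h])
  have b1 := e (c2 I).imI (by linarith)
  have b2 := e (c2 I).imJ (by linarith)
  have b3 := e (c2 I).imK (by linarith)
  rw [b0, b1, b2, b3] at h11 h12 h13 h10
  have a1 := e (c1 I).imI (by linarith)
  have a2 := e (c1 I).imJ (by linarith)
  have a3 := e (c1 I).imK (by linarith)
  rw [a1, a2, a3] at h10
  nlinarith

/-- Left alternativity for imaginary units. -/
theorem mul_mul_of_mem_Sph {I : Oct} (hI : I ∈ Sph) (w : Oct) : I * (I * w) = -w := by
  have hre := re_c1_of_mem_Sph hI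
  have hI' : I * I = -1 := hI
  have h1 := congrArg (fun p => (c1 p).re) hI'
  simp [c1_mul, c1_neg, c1_one] at h1
  apply ext_c <;> ext <;> simp [c1_mul, c2_mul, c1_neg, c2_neg, hre]
  · linear_combination (c1 w).re * h1 - (c1 w).re * (c1 I).re * hre
  · linear_combination (c1 w).imI * h1 - (c1 w).imI * (c1 I).re * hre
  · linear_combination (c1 w).imJ * h1 - (c1 w).imJ * (c1 I).re * hre
  · linear_combination (c1 w).imK * h1 - (c1 w).imK * (c1 I).re * hre
  · linear_combination (c2 w).re * h1 - (c2 w).re * (c1 I).re * hre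
  · linear_combination (c2 w).imI * h1 - (c2 w).imI * (c1 I).re * hre
  · linear_combination (c2 w).imJ * h1 - (c2 w).imJ * (c1 I).re * hre
  · linear_combination (c2 w).imK * h1 - (c2 w).imK * (c1 I).re * hre

theorem mk_zero_mem_Sph {a : ℍ} (hre : a.re = 0) (him : a.imI ^ 2 + a.imJ ^ 2 + a.imK ^ 2 = 1) :
    mk a 0 ∈ Sph := by
  have ha : a * a = -1 := by
    ext <;> simp [hre]
    · linear_combination -him
    · ring
    · ring
    · ring
  apply ext_c <;> simp [c1_mul, c2_mul, c1_mk, c2_mk, c1_neg, c2_neg, c1_one, c2_one, ha]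

theorem mk_imI_mem_Sph : mk ⟨0, 1, 0, 0⟩ 0 ∈ Sph :=
  mk_zero_mem_Sph rfl (by norm_num)

theorem mk_imJ_mem_Sph : mk ⟨0, 0, 1, 0⟩ 0 ∈ Sph :=
  mk_zero_mem_Sph rfl (by norm_num)

theorem exists_mem_Sph_ne (I : Oct) : ∃ J ∈ Sph, J ≠ I ∧ J ≠ -I := by
  by_contra! hc
  have hIJ : ∀ r : ℝ, mk ⟨0, 1, 0, 0⟩ 0 ≠ r • mk ⟨0, 0, 1, 0⟩ 0 := fun r h => by
    have h1 : (1 : ℝ) = r * 0 := congrArg (fun p => (c1 p).imI) h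
    simp at h1
  have h1 := hc _ mk_imI_mem_Sph
  have h2 := hc _ mk_imJ_mem_Sph
  by_cases e1 : mk ⟨0, 1, 0, 0⟩ 0 = I <;> by_cases e2 : mk ⟨0, 0, 1, 0⟩ 0 = I
  · exact hIJ 1 (by rw [e1, e2, one_smul])
  · exact hIJ (-1) (by rw [e1, h2 e2]; simp)
  · exact hIJ (-1) (by rw [h1 e1, e2]; simp)
  · exact hIJ 1 (by rw [h1 e1, h2 e2, one_smul])

theorem smul_one_add_smul_inj {I J : Oct} (hI : I ∈ Sph) (hJ : J ∈ Sph) {s t s' t' : ℝ}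
    (h : s • (1 : Oct) + t • J = s' • (1 : Oct) + t' • I) : s = s' ∧ t • J = t' • I := by
  have h1 := congrArg (fun p => (c1 p).re) h
  simp [c1_add, c1_smul, c1_one, re_c1_of_mem_Sph hI, re_c1_of_mem_Sph hJ] at h1
  subst h1
  exact ⟨rfl, add_left_cancel h⟩

theorem eq_or_eq_neg_of_smul_eq {I J : Oct} (hI : I ∈ Sph) (hJ : J ∈ Sph) {t t' : ℝ}
    (ht : t ≠ 0) (h : t • J = t' • I) : J = I ∨ J = -I := by
  have hJI : J = (t⁻¹ * t') • I := by rw [mul_smul, ← h, inv_smul_smul₀ ht]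
  have hI' : I * I = -1 := hI
  have hJ' : J * J = -1 := hJ
  rw [hJI, smul_mul_smul', hI'] at hJ'
  have h1 := congrArg (fun p => (c1 p).re) hJ'
  simp only [c1_smul, c1_neg, c1_one, Quaternion.re_smul, Quaternion.re_neg, Quaternion.re_one,
    smul_eq_mul, mul_neg, mul_one, neg_inj] at h1
  rcases mul_self_eq_one_iff.1 h1 with h2 | h2
  · left; rw [hJI, h2, one_smul]
  · right; rw [hJI, h2]; simp

end Oct

section Slices

variable {n : ℕ}

theorem aff_zero (x : Fin n → ℝ) (I J : Oct) : aff x 0 I = aff x 0 J :=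
  funext fun m => by simp [aff]

theorem aff_neg (x y : Fin n → ℝ) (I : Oct) : aff x (-y) I = aff x y (-I) :=
  funext fun m => by simp [aff]

theorem aff_eq_aff {x y x' y' : Fin n → ℝ} {I J : Oct} (hI : I ∈ Sph) (hJ : J ∈ Sph)
    (h : aff x y J = aff x' y' I) : x = x' ∧ ∀ m, y m • J = y' m • I :=
  ⟨funext fun m => (smul_one_add_smul_inj hI hJ (congrFun h m)).1,
    fun m => (smul_one_add_smul_inj hI hJ (congrFun h m)).2⟩

theorem ne_zero_of_mem_Sph {I : Oct} (hI : I ∈ Sph) : I ≠ 0 := by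
  rintro rfl
  have h : (0 : Oct) * 0 = -1 := hI
  have h1 := congrArg (fun p => (c1 p).re) h
  have h0 : (0 : Oct) * 0 = 0 := map_zero (mulLeft 0)
  rw [h0] at h1
  norm_num [c1_neg, c1_one] at h1
  have : (c1 (0 : Oct)).re = 0 := rfl
  linarith

theorem aff_right_injective {x y x' y' : Fin n → ℝ} {I : Oct} (hI : I ∈ Sph)
    (h : aff x y I = aff x' y' I) : (x, y) = (x', y') := by
  obtain ⟨hx, hy⟩ := aff_eq_aff hI hI h
  exact Prod.ext hx (funext fun m => smul_left_injective ℝ (ne_zero_of_mem_Sph hI) (hy m))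

theorem isOpen_τs_iff {A : Set (Fin n → Oct)} :
    IsOpen[τs n] A ↔ ∀ I ∈ Sph, IsOpen {p : (Fin n → ℝ) × (Fin n → ℝ) | aff p.1 p.2 I ∈ A} :=
  ⟨fun h I hI => isOpen_coinduced.1 (isOpen_iSup_iff.1 h ⟨I, hI⟩),
    fun h => isOpen_iSup_iff.2 fun I => isOpen_coinduced.2 (h I.1 I.2)⟩

/-- The reflection `(x, y) ↦ (x, -y)`. -/
def conjCLM (n : ℕ) : (Fin n → ℝ) × (Fin n → ℝ) →L[ℝ] (Fin n → ℝ) × (Fin n → ℝ) :=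
  (ContinuousLinearMap.fst ℝ _ _).prod (-ContinuousLinearMap.snd ℝ _ _)

@[simp] theorem conjCLM_apply (p : (Fin n → ℝ) × (Fin n → ℝ)) : conjCLM n p = (p.1, -p.2) := rfl

theorem AxSymm.mem_iff {Ω : Set (Fin n → Oct)} (hax : AxSymm n Ω) {I J : Oct} (hI : I ∈ Sph)
    (hJ : J ∈ Sph) (x y : Fin n → ℝ) : aff x y I ∈ Ω ↔ aff x y J ∈ Ω :=
  ⟨hax x y I hI J hJ, hax x y J hJ I hI⟩

/-- On an axially symmetric slice-domain, a relatively clopen part of `Ω_{s₁}` without real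
points is empty. -/
theorem SliceDomain.eq_empty_of_no_real {Ω : Set (Fin n → Oct)} (hΩ : SliceDomain n Ω)
    (hax : AxSymm n Ω) {I : Oct} (hI : I ∈ Sph) {N : Set ((Fin n → ℝ) × (Fin n → ℝ))}
    (hNV : N ⊆ {p | aff p.1 p.2 I ∈ Ω}) (hN : IsOpen N)
    (hN' : IsOpen ({p | aff p.1 p.2 I ∈ Ω} \ N)) (hreal : ∀ x, (x, 0) ∉ N) : N = ∅ := by
  set A : Set (Fin n → Oct) := {q | ∃ p ∈ N, q = aff p.1 p.2 I} with hA
  have hmem (x y : Fin n → ℝ) : aff x y I ∈ A ↔ (x, y) ∈ N := by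
    constructor
    · rintro ⟨p, hp, h⟩
      rwa [aff_right_injective hI h]
    · exact fun h => ⟨_, h, rfl⟩
  have hmem' (x y : Fin n → ℝ) : aff x y (-I) ∈ A ↔ (x, -y) ∈ N := by
    rw [← aff_neg, hmem]
  have hnot {J : Oct} (hJ : J ∈ Sph) (h1 : J ≠ I) (h2 : J ≠ -I) (x y : Fin n → ℝ) :
      aff x y J ∉ A := by
    rintro ⟨⟨x', y'⟩, hp, h⟩
    obtain ⟨-, hy⟩ := aff_eq_aff hI hJ h
    refine hreal x' ?_
    convert hp using 2
    funext m
    by_contra hne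
    have hy0 : y m ≠ 0 := by
      rintro h0
      have := hy m
      rw [h0, zero_smul] at this
      exact (smul_ne_zero (Ne.symm hne) (ne_zero_of_mem_Sph hI)) this.symm
    rcases eq_or_eq_neg_of_smul_eq hI hJ hy0 (hy m) with h | h
    · exact h1 h
    · exact h2 h
  have hAΩ : A ⊆ Ω := by
    rintro _ ⟨p, hp, rfl⟩
    exact hNV hp
  have hopen := isOpen_τs_iff.1 hΩ.1.2
  have hAo : IsOpen[τs n] A := by
    refine isOpen_τs_iff.2 fun J hJ => ?_
    by_cases h1 : J = I
    · subst h1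
      simp only [hmem]
      exact hN
    by_cases h2 : J = -I
    · subst h2
      simp only [hmem']
      exact hN.preimage (conjCLM n).continuous
    · simp only [hnot hJ h1 h2, Set.ofPred_false, isOpen_empty]
  have hBo : IsOpen[τs n] (Ω \ A) := by
    refine isOpen_τs_iff.2 fun J hJ => ?_
    by_cases h1 : J = I
    · subst h1
      simp only [Set.mem_sdiff, hmem]
      exact hN'
    by_cases h2 : J = -I
    · subst h2
      simp only [Set.mem_sdiff, ← aff_neg, hmem]
      exact hN'.preimage (conjCLM n).continuous
    · simp only [Set.mem_sdiff, hnot hJ h1 h2, not_false_eq_true, and_true]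
      exact hopen J hJ
  by_contra hne
  obtain ⟨⟨x, y⟩, hp⟩ := Set.nonempty_iff_ne_empty.2 hne
  let _ := τs n
  have hsub : Ω ⊆ A := hΩ.2.isPreconnected.subset_left_of_subset_union hAo hBo
    Set.disjoint_sdiff_right (by rw [Set.union_sdiff_cancel hAΩ])
    ⟨aff x y I, hNV hp, (hmem x y).2 hp⟩
  obtain ⟨J, hJ, h1, h2⟩ := exists_mem_Sph_ne I
  exact hnot hJ h1 h2 x y (hsub (hax x y I hI J hJ (hNV hp)))

theorem WSliceReg.holoWrt {Ω : Set (Fin n → Oct)} {f : (Fin n → Oct) → Oct}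
    (hf : WSliceReg n Ω f) {I : Oct} (hI : I ∈ Sph) :
    HoloWrt (mulLeft I) (fun p => f (aff p.1 p.2 I)) {p | aff p.1 p.2 I ∈ Ω} :=
  hf I hI

/-- A function holomorphic along one slice of a symmetric domain, split into its stem
components: `g = F₁ + J F₂` with `F₁`, `F₂` even and odd in `y`. -/
def stemOf (J : Oct) (g : (Fin n → ℝ) × (Fin n → ℝ) → Oct)
    (p : (Fin n → ℝ) × (Fin n → ℝ)) : Oct × Oct :=
  ((2⁻¹ : ℝ) • (g p + g (conjCLM n p)), -((2⁻¹ : ℝ) • mulLeft J (g p - g (conjCLM n p))))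

variable {J : Oct} {g : (Fin n → ℝ) × (Fin n → ℝ) → Oct} {V : Set ((Fin n → ℝ) × (Fin n → ℝ))}

theorem HoloWrt.contDiffOn_stemOf (hg : HoloWrt (mulLeft J) g V)
    (hsymm : ∀ p ∈ V, conjCLM n p ∈ V) : ContDiffOn ℝ 1 (stemOf J g) V := by
  have h1 := hg.1
  have h2 : ContDiffOn ℝ 1 (fun p => g (conjCLM n p)) V :=
    hg.1.comp (conjCLM n).contDiff.contDiffOn hsymm
  exact ((h1.add h2).const_smul _).prodMk
    (((mulLeft J).contDiff.comp_contDiffOn (h1.sub h2)).const_smul _).neg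

theorem HoloWrt.fderiv_stemOf (hJ : J ∈ Sph) (hV : IsOpen V) (hg : HoloWrt (mulLeft J) g V)
    (hsymm : ∀ p ∈ V, conjCLM n p ∈ V) {p : (Fin n → ℝ) × (Fin n → ℝ)} (hp : p ∈ V)
    (m : Fin n) :
    fderiv ℝ (stemOf J g) p (Pi.single m 1, 0) +
      sigma2 (fderiv ℝ (stemOf J g) p (0, Pi.single m 1)) = 0 := by
  have hd (q) (hq : q ∈ V) : HasFDerivAt g (fderiv ℝ g q) q :=
    ((hg.1.differentiableOn one_ne_zero).differentiableAt (hV.mem_nhds hq)).hasFDerivAt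
  have hcr1 := eq_neg_of_add_eq_zero_left (hg.2 p hp m)
  have hcr2 := eq_neg_of_add_eq_zero_left (hg.2 _ (hsymm p hp) m)
  have hd1 := hd p hp
  have hd2 := (hd _ (hsymm p hp)).comp p (conjCLM n).hasFDerivAt
  set A := fderiv ℝ g p
  set B := fderiv ℝ g (conjCLM n p)
  have hF : HasFDerivAt (stemOf J g) _ p := ((hd1.add hd2).const_smul (2⁻¹ : ℝ)).prodMk
    ((((mulLeft J).hasFDerivAt.comp p (hd1.sub hd2)).const_smul (2⁻¹ : ℝ)).neg)
  have hn : B (0, -Pi.single m 1) = -B (0, Pi.single m 1) := by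
    rw [← map_neg]; simp
  have hJJ (w : Oct) : mulLeft J (mulLeft J w) = -w := mul_mul_of_mem_Sph hJ w
  rw [hF.fderiv]
  refine Prod.ext ?_ ?_
  · simp [-mulLeft_apply, sigma2, hcr1, hcr2, hn, smul_add]
    abel
  · simp [-mulLeft_apply, sigma2, hcr1, hcr2, hn, hJJ, smul_add, smul_sub]
    abel

theorem stemOf_real (x : Fin n → ℝ) : stemOf J g (x, 0) = (g (x, 0), 0) := by
  ext1
  · simp only [stemOf, conjCLM_apply, neg_zero, ← two_smul ℝ (g (x, 0)), smul_smul]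
    norm_num
  · simp [-mulLeft_apply, stemOf]

/-- A holomorphic stem map induces a holomorphic function on each slice. -/
theorem holoWrt_of_stem {F : (Fin n → ℝ) × (Fin n → ℝ) → Oct × Oct} {I : Oct} (hI : I ∈ Sph)
    (hV : IsOpen V) (hF : ContDiffOn ℝ 1 F V)
    (hcr : ∀ p ∈ V, ∀ m : Fin n,
      fderiv ℝ F p (Pi.single m 1, 0) + sigma2 (fderiv ℝ F p (0, Pi.single m 1)) = 0) :
    HoloWrt (mulLeft I) (fun p => (F p).1 + mulLeft I (F p).2) V := by
  refine ⟨hF.fst.add ((mulLeft I).contDiff.comp_contDiffOn hF.snd), fun p hp m => ?_⟩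
  have hd := ((hF.differentiableOn one_ne_zero).differentiableAt (hV.mem_nhds hp)).hasFDerivAt
  have hG : HasFDerivAt (fun p => (F p).1 + mulLeft I (F p).2) _ p :=
    hd.fst.add ((mulLeft I).hasFDerivAt.comp p hd.snd)
  have h := eq_neg_of_add_eq_zero_left (hcr p hp m)
  have hII (w : Oct) : mulLeft I (mulLeft I w) = -w := mul_mul_of_mem_Sph hI w
  rw [hG.fderiv]
  simp [-mulLeft_apply, h, sigma2, hII]

theorem HoloWrt.sub {E : Type*} [NormedAddCommGroup E] [NormedSpace ℝ E] {T : E →L[ℝ] E}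
    {g h : (Fin n → ℝ) × (Fin n → ℝ) → E} (hV : IsOpen V) (hg : HoloWrt T g V)
    (hh : HoloWrt T h V) : HoloWrt T (g - h) V := by
  refine ⟨hg.1.sub hh.1, fun p hp m => ?_⟩
  have h1 := (hg.1.differentiableOn one_ne_zero).differentiableAt (hV.mem_nhds hp)
  have h2 := (hh.1.differentiableOn one_ne_zero).differentiableAt (hV.mem_nhds hp)
  rw [fderiv_sub h1 h2]
  simp only [sub_apply, map_sub, eq_neg_of_add_eq_zero_left (hg.2 p hp m),
    eq_neg_of_add_eq_zero_left (hh.2 p hp m)]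
  abel

/-- Identity principle: slice-holomorphic functions on an axially symmetric slice-domain that
agree at the real points agree. -/
theorem SliceDomain.eqOn_of_eqOn_real {Ω : Set (Fin n → Oct)} (hΩ : SliceDomain n Ω)
    (hax : AxSymm n Ω) {I : Oct} (hI : I ∈ Sph) {g h : (Fin n → ℝ) × (Fin n → ℝ) → Oct}
    (hg : HoloWrt (mulLeft I) g {p | aff p.1 p.2 I ∈ Ω})
    (hh : HoloWrt (mulLeft I) h {p | aff p.1 p.2 I ∈ Ω})
    (h0 : ∀ x, g (x, 0) = h (x, 0)) :
    Set.EqOn g h {p | aff p.1 p.2 I ∈ Ω} := by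
  set V : Set ((Fin n → ℝ) × (Fin n → ℝ)) := {p | aff p.1 p.2 I ∈ Ω}
  have hV : IsOpen V := isOpen_τs_iff.1 hΩ.1.2 I hI
  have hII : ∀ w, mulLeft I (mulLeft I w) = -w := mul_mul_of_mem_Sph hI
  have hd := hg.sub hV hh
  have hN : V \ interior {p | (g - h) p = 0} = ∅ := by
    refine hΩ.eq_empty_of_no_real hax hI Set.sdiff_subset (hd.isOpen_diff_interior_zeros hII hV)
      ?_ fun x hx => hx.2 (hd.mem_interior_zeros_of_real hII hV (fun x _ => by simp [h0]) hx.1)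
    change IsOpen (V \ (V \ _))
    rw [Set.sdiff_sdiff_right_self]
    exact hV.inter isOpen_interior
  intro p hp
  have hp0 : p ∈ {p | (g - h) p = 0} := interior_subset (Set.sdiff_eq_empty.1 hN hp)
  exact sub_eq_zero.1 hp0

end Slices

/-- A weak slice regular function on an axially symmetric
slice-domain is strong slice regular. -/
theorem weak_slice_regular_is_strong (n : ℕ) (hn : 1 ≤ n)
    (Ω : Set (Fin n → Oct)) (hΩ : SliceDomain n Ω) (hax : AxSymm n Ω)
    (f : (Fin n → Oct) → Oct) (hf : WSliceReg n Ω f) :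
    SSliceReg n Ω f := by
  have hJ := mk_imI_mem_Sph
  set J := mk ⟨0, 1, 0, 0⟩ 0
  set V : Set ((Fin n → ℝ) × (Fin n → ℝ)) := {p | aff p.1 p.2 J ∈ Ω}
  have hVI {I : Oct} (hI : I ∈ Sph) : {p | aff p.1 p.2 I ∈ Ω} = V :=
    Set.ext fun p => hax.mem_iff hI hJ p.1 p.2
  have hV : IsOpen V := isOpen_τs_iff.1 hΩ.1.2 J hJ
  have hsymm : ∀ p ∈ V, conjCLM n p ∈ V := fun p hp => by
    change aff p.1 (-p.2) J ∈ Ω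
    rw [aff_neg]
    exact hax _ _ _ hJ _ (neg_mem_Sph hJ) hp
  have hg := hf.holoWrt hJ
  have hF := hg.contDiffOn_stemOf hsymm
  have hcr := fun p hp m => hg.fderiv_stemOf hJ hV hsymm (p := p) hp m
  refine ⟨stemOf J fun p => f (aff p.1 p.2 J), ⟨V, _, hV, ?_, fun _ _ => rfl, hF, hcr⟩, ?_⟩
  · rintro p ⟨I, hI, hp⟩
    exact hax _ _ I hI J hJ hp
  · intro x y I hI hxy
    have hG := holoWrt_of_stem hI hV hF hcr
    rw [← hVI hI] at hG
    refine hΩ.eqOn_of_eqOn_real hax hI (hf.holoWrt hI) hG (fun x => ?_)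
      (show (x, y) ∈ {p | aff p.1 p.2 I ∈ Ω} from hxy)
    simp only [stemOf_real, map_zero, add_zero, aff_zero x I J]

end
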